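/- Let k_x ≥ 3 be an integer and ℓ > 1. The density of Δ := 1 − B^{1/ℓ}, where B has distribution Beta(1, k_x − 1), namely f_Δ(δ) = (ℓ/B(k_x−1, 1)) · (1 − (1−δ)^ℓ)^{k_x−2} · (1−δ)^{ℓ−1} on [0,1], attains its unique global maximum at δ_m = 1 − ((ℓ − 1)/((k_x − 1)ℓ − 1))^{1/ℓ}. -/

import Mathlib

open Set Real

/-- The Beta function `B(a,b) = ∫_0^1 τ^{a-1}(1-τ)^{b-1} dτ` for positive integer arguments. -/
noncomputable def betaFn (a b : ℕ) : ℝ :=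
  ∫ τ in (0:ℝ)..1, τ ^ (a - 1) * (1 - τ) ^ (b - 1)

/-- The kernel `(1 - y)^a * y^p` of a Beta density has its unique maximum over `[0,1]` at
`p / (a + p)`. -/
theorem one_sub_rpow_mul_rpow_lt {a p y : ℝ} (ha : 0 < a) (hp : 0 < p) (hy : y ∈ Icc (0:ℝ) 1)
    (hne : y ≠ p / (a + p)) :
    (1 - y) ^ a * y ^ p < (1 - p / (a + p)) ^ a * (p / (a + p)) ^ p := by
  have hap : 0 < a + p := add_pos ha hp
  have hsub : 1 - p / (a + p) = a / (a + p) := by field_simp; ring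
  rw [hsub]
  have hpos : 0 < (a / (a + p)) ^ a * (p / (a + p)) ^ p := by positivity
  rcases hy.1.eq_or_lt with rfl | hy0
  · simpa [zero_rpow hp.ne'] using hpos
  rcases hy.2.eq_or_lt with rfl | hy1
  · simpa [zero_rpow ha.ne'] using hpos
  have hy1' : 0 < 1 - y := sub_pos.2 hy1
  have hlog : ∀ {u v : ℝ}, 0 < u → 0 < v → log (u ^ a * v ^ p) = a * log u + p * log v := by
    intro u v hu hv
    rw [log_mul (by positivity) (by positivity), log_rpow hu, log_rpow hv]
  rw [← log_lt_log_iff (by positivity) hpos, hlog hy1' hy0, hlog (by positivity) (by positivity)]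
  have hlt : log (y / (p / (a + p))) < y / (p / (a + p)) - 1 :=
    log_lt_sub_one_of_pos (by positivity) fun h => hne ((div_eq_one_iff_eq (by positivity)).1 h)
  have hle : log ((1 - y) / (a / (a + p))) ≤ (1 - y) / (a / (a + p)) - 1 :=
    log_le_sub_one_of_pos (by positivity)
  rw [log_div (by positivity) (by positivity)] at hlt hle
  have hlt' := mul_lt_mul_of_pos_left hlt hp
  have hle' := mul_le_mul_of_nonneg_left hle ha.le
  have hzero : a * ((1 - y) / (a / (a + p)) - 1) + p * (y / (p / (a + p)) - 1) = 0 := by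
    field_simp
    ring
  linarith

theorem betaFn_one_pos (a : ℕ) : 0 < betaFn a 1 := by
  have : betaFn a 1 = 1 / ((a - 1 : ℕ) + 1) := by simp [betaFn]
  rw [this]
  positivity

/-- special case `k_t = 1`: for an integer `k_x ≥ 3` and `ℓ > 1`, the density
`f_Δ(δ) = (ℓ/B(k_x−1,1)) (1−(1−δ)^ℓ)^{k_x−2} (1−δ)^{ℓ−1}` on `[0,1]` attains its unique
global maximum at `δ_m = 1 − ((ℓ−1)/((k_x−1)ℓ−1))^{1/ℓ}`. -/
theorem mode_special_case_kt_one
    (kx : ℕ) (hkx : 3 ≤ kx) (ℓ : ℝ) (hℓ : 1 < ℓ) :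
    let f : ℝ → ℝ := fun δ =>
      (ℓ / betaFn (kx - 1) 1) * (1 - (1 - δ) ^ ℓ) ^ (kx - 2) * (1 - δ) ^ (ℓ - 1)
    let δm : ℝ := 1 - ((ℓ - 1) / (((kx : ℝ) - 1) * ℓ - 1)) ^ (1 / ℓ)
    δm ∈ Icc (0:ℝ) 1 ∧ ∀ δ ∈ Icc (0:ℝ) 1, δ ≠ δm → f δ < f δm := by
  intro f δm
  obtain ⟨n, rfl⟩ : ∃ n, kx = n + 2 := ⟨kx - 2, by omega⟩
  have hn : (0:ℝ) < n := by exact_mod_cast (by omega : 0 < n)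
  have hℓ0 : 0 < ℓ := by linarith
  have hp : 0 < (ℓ - 1) / ℓ := div_pos (by linarith) hℓ0
  set p := (ℓ - 1) / ℓ with hp_def
  have hmode : (ℓ - 1) / ((((n + 2 : ℕ) : ℝ) - 1) * ℓ - 1) = p / (n + p) := by
    have hden : n + p = ((((n + 2 : ℕ) : ℝ) - 1) * ℓ - 1) / ℓ := by
      rw [hp_def]
      push_cast
      field_simp
      ring
    rw [hden, hp_def, div_div_div_cancel_right₀ hℓ0.ne']
  have hm0 : 0 ≤ p / (n + p) := by positivity
  have hm1 : p / (n + p) ≤ 1 := (div_le_one (by positivity)).2 (by linarith)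
  have hδm : 1 - δm = (p / (n + p)) ^ (1 / ℓ) := by
    simp only [δm, hmode, sub_sub_cancel]
  have hδm_pow : (1 - δm) ^ ℓ = p / (n + p) := by
    rw [hδm, ← rpow_mul hm0, one_div_mul_cancel hℓ0.ne', rpow_one]
  have hmem : δm ∈ Icc (0:ℝ) 1 := by
    have h0 : 0 ≤ 1 - δm := hδm ▸ rpow_nonneg hm0 _
    have h1 : 1 - δm ≤ 1 := hδm ▸ rpow_le_one hm0 hm1 (by positivity)
    constructor <;> linarith
  have hc : 0 < ℓ / betaFn (n + 1) 1 := div_pos hℓ0 (betaFn_one_pos _)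
  have hf : ∀ δ ≤ (1:ℝ), f δ = ℓ / betaFn (n + 1) 1 *
      ((1 - (1 - δ) ^ ℓ) ^ (n : ℝ) * ((1 - δ) ^ ℓ) ^ p) := by
    intro δ hδ
    have hexp : ℓ * p = ℓ - 1 := mul_div_cancel₀ _ hℓ0.ne'
    rw [rpow_natCast, ← rpow_mul (sub_nonneg.2 hδ), hexp, ← mul_assoc]
    rfl
  refine ⟨hmem, fun δ hδ hne => ?_⟩
  rw [hf δ hδ.2, hf δm hmem.2, hδm_pow]
  have hδ0 : 0 ≤ 1 - δ := sub_nonneg.2 hδ.2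
  refine mul_lt_mul_of_pos_left (one_sub_rpow_mul_rpow_lt hn hp
    ⟨rpow_nonneg hδ0 _, rpow_le_one hδ0 (by linarith [hδ.1]) hℓ0.le⟩ fun h => hne ?_) hc
  have := (rpow_left_inj hδ0 (sub_nonneg.2 hmem.2) hℓ0.ne').1 (h.trans hδm_pow.symm)
  linarith
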